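/- Let S(b) = (1/2)∑_{p ∈ 2πℤ³\{0}} h(p) with h(p) = √(|p|⁴ + 2b|p|²) - |p|² - b + b²/(2|p|²), b > 0 large. Then |S(b) - (1/2)(2π)^{-3}·(2π)³·∫_{ℝ³}h(p)dp·(2π)^{-3}·(2π)³| = |S(b) - (1/2)(2π)^{-3}∫_{ℝ³}h(p)dp| ≤ C b^{5/2 - c} for some c > 0, i.e. the Riemann sum over the lattice 2πℤ³ of the LHY integrand converges to the integral with a relative error vanishing as a power of b. -/

import Mathlib

open MeasureTheory

/-- Euclidean norm of a lattice point of `ℤ³`. -/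
noncomputable def latticeNorm (k : Fin 3 → ℤ) : ℝ := Real.sqrt (∑ i, ((k i : ℝ))^2)

/-- The Lee–Huang–Yang integrand as a radial function. -/
noncomputable def lhyIntegrand (b r : ℝ) : ℝ :=
  Real.sqrt (r^4 + 2*b*r^2) - r^2 - b + b^2 / (2*r^2)

/-- The Lee–Huang–Yang integrand in terms of `u = r²`. -/
noncomputable def lhyProfile (b u : ℝ) : ℝ :=
  Real.sqrt (u ^ 2 + 2 * b * u) - u - b + b ^ 2 / (2 * u)

lemma lhyIntegrand_eq_lhyProfile (b r : ℝ) : lhyIntegrand b r = lhyProfile b (r ^ 2) := by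
  unfold lhyIntegrand lhyProfile
  ring_nf

lemma lhyProfile_bounds {b u : ℝ} (hb : 0 < b) (hu : 0 < u) :
    0 ≤ lhyProfile b u ∧ lhyProfile b u ≤ b ^ 2 / (2 * u) ∧
      lhyProfile b u ≤ b ^ 3 / (2 * u ^ 2) := by
  have hpos : 0 < u ^ 2 + 2 * b * u := by positivity
  set S := Real.sqrt (u ^ 2 + 2 * b * u) with hS
  have hS0 : 0 < S := Real.sqrt_pos.2 hpos
  have hSsq : S ^ 2 = u ^ 2 + 2 * b * u := Real.sq_sqrt hpos.le
  have huS : u ≤ S := by nlinarith [mul_pos hb hu]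
  have hSu : S ≤ u + b := by nlinarith
  have hH : lhyProfile b u = b ^ 2 / (2 * u) - b ^ 2 / (S + u + b) := by
    have : u + b - S = b ^ 2 / (S + u + b) := by
      rw [eq_div_iff (by positivity)]
      linear_combination -hSsq
    rw [← this, lhyProfile, ← hS]
    ring
  have h1 : b ^ 2 / (S + u + b) ≤ b ^ 2 / (2 * u) :=
    div_le_div_of_nonneg_left (by positivity) (by positivity) (by linarith)
  have h2 : 0 ≤ b ^ 2 / (S + u + b) := by positivity
  have h3 : b ^ 2 / (2 * u + 2 * b) ≤ b ^ 2 / (S + u + b) :=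
    div_le_div_of_nonneg_left (by positivity) (by positivity) (by linarith)
  have h4 : b ^ 2 / (2 * u) - b ^ 2 / (2 * u + 2 * b) ≤ b ^ 3 / (2 * u ^ 2) := by
    have : b ^ 2 / (2 * u) - b ^ 2 / (2 * u + 2 * b) = b ^ 3 / (2 * u * (u + b)) := by
      field_simp
      ring
    rw [this]
    exact div_le_div_of_nonneg_left (by positivity) (by positivity)
      (by nlinarith [mul_pos hb hu])
  exact ⟨by linarith, by linarith, by linarith⟩

lemma hasDerivAt_lhyProfile {b u : ℝ} (hb : 0 < b) (hu : 0 < u) :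
    HasDerivAt (lhyProfile b)
      ((u + b) / Real.sqrt (u ^ 2 + 2 * b * u) - 1 - b ^ 2 / (2 * u ^ 2)) u := by
  have hpos : 0 < u ^ 2 + 2 * b * u := by positivity
  have hS0 : 0 < Real.sqrt (u ^ 2 + 2 * b * u) := Real.sqrt_pos.2 hpos
  have hq : HasDerivAt (fun v : ℝ => v ^ 2 + 2 * b * v) (2 * u + 2 * b) u := by
    refine ((hasDerivAt_pow 2 u).add ((hasDerivAt_id u).const_mul (2 * b))).congr_deriv ?_
    simp
  have hi : HasDerivAt (fun v : ℝ => b ^ 2 / 2 * v⁻¹) (b ^ 2 / 2 * (-(u ^ 2)⁻¹)) u :=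
    (hasDerivAt_inv hu.ne').const_mul _
  have h := (((hq.sqrt hpos.ne').sub (hasDerivAt_id u)).sub_const b).add hi
  refine (h.congr_deriv ?_).congr_of_eventuallyEq (Filter.Eventually.of_forall fun v => ?_)
  · field_simp
    ring
  · simp only [lhyProfile, Pi.add_apply, Pi.sub_apply, id]
    rw [div_mul_eq_div_div, div_eq_mul_inv _ v]

lemma abs_deriv_lhyProfile_le {b u : ℝ} (hb : 0 < b) (hu : 0 < u) :
    |(u + b) / Real.sqrt (u ^ 2 + 2 * b * u) - 1 - b ^ 2 / (2 * u ^ 2)|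
      ≤ (b / u) ^ (9 / 4 : ℝ) := by
  have hpos : 0 < u ^ 2 + 2 * b * u := by positivity
  set S := Real.sqrt (u ^ 2 + 2 * b * u) with hS
  have hS0 : 0 < S := Real.sqrt_pos.2 hpos
  have hSsq : S ^ 2 = u ^ 2 + 2 * b * u := Real.sq_sqrt hpos.le
  have huS : u ≤ S := by nlinarith [mul_pos hb hu]
  have hSu : S ≤ u + b := by nlinarith
  have hA : (u + b) / S - 1 = b ^ 2 / (S * (S + u + b)) := by
    rw [div_sub_one hS0.ne', div_eq_div_iff hS0.ne' (by positivity)]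
    linear_combination (-S) * hSsq
  have h0 : 0 ≤ b ^ 2 / (S * (S + u + b)) := by positivity
  have h1 : b ^ 2 / (S * (S + u + b)) ≤ b ^ 2 / (2 * u ^ 2) := by
    refine div_le_div_of_nonneg_left (by positivity) (by positivity) ?_
    nlinarith
  have h2 : b ^ 2 / (2 * u ^ 2) ≤ (b / u) ^ 2 := by
    rw [div_pow]
    gcongr
    nlinarith [sq_nonneg u]
  have h3 : b ^ 2 / (2 * u ^ 2) - b ^ 2 / (S * (S + u + b)) ≤ (b / u) ^ 3 := by
    have hD : S * (S + u + b) ≤ 2 * u ^ 2 + 4 * b * u + b ^ 2 := by nlinarith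
    have h4 : b ^ 2 / (2 * u ^ 2 + 4 * b * u + b ^ 2) ≤ b ^ 2 / (S * (S + u + b)) := by
      gcongr
    have h5 : b ^ 2 / (2 * u ^ 2) - b ^ 2 / (2 * u ^ 2 + 4 * b * u + b ^ 2) ≤ (b / u) ^ 3 := by
      rw [div_sub_div _ _ (by positivity) (by positivity), div_pow,
        div_le_div_iff₀ (by positivity) (by positivity), ← sub_nonneg]
      have : b ^ 3 * (2 * u ^ 2 * (2 * u ^ 2 + 4 * b * u + b ^ 2)) -
          (b ^ 2 * (2 * u ^ 2 + 4 * b * u + b ^ 2) - 2 * u ^ 2 * b ^ 2) * u ^ 3 =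
          7 * b ^ 4 * u ^ 3 + 2 * b ^ 5 * u ^ 2 := by ring
      rw [this]
      positivity
    linarith
  have hx : 0 < b / u := by positivity
  rw [hA, abs_of_nonpos (by linarith)]
  rcases le_total 1 (b / u) with hge | hle
  · have : (b / u) ^ (2 : ℝ) ≤ (b / u) ^ (9 / 4 : ℝ) :=
      Real.rpow_le_rpow_of_exponent_le hge (by norm_num)
    rw [Real.rpow_two] at this
    linarith
  · have : (b / u) ^ (3 : ℝ) ≤ (b / u) ^ (9 / 4 : ℝ) :=
      Real.rpow_le_rpow_of_exponent_ge hx hle (by norm_num)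
    rw [show (3 : ℝ) = (3 : ℕ) by norm_num, Real.rpow_natCast] at this
    linarith

lemma abs_lhyProfile_sub_le {b m u v : ℝ} (hb : 0 < b) (hm : 0 < m) (hu : m ≤ u) (hv : m ≤ v) :
    |lhyProfile b u - lhyProfile b v| ≤ (b / m) ^ (9 / 4 : ℝ) * |u - v| := by
  have := Convex.norm_image_sub_le_of_norm_hasDerivWithin_le (s := Set.Ici m)
    (f := lhyProfile b) (C := (b / m) ^ (9 / 4 : ℝ))
    (fun x hx => (hasDerivAt_lhyProfile hb (hm.trans_le hx)).hasDerivWithinAt)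
    (fun x hx => ?_) (convex_Ici m) hv hu
  · simpa [Real.norm_eq_abs] using this
  · rw [Real.norm_eq_abs]
    have hx0 : 0 < x := hm.trans_le hx
    refine (abs_deriv_lhyProfile_le hb hx0).trans ?_
    have hmx : m ≤ x := hx
    gcongr

/-- A radial weight integrable on `ℝ³`. -/
noncomputable def radialWeight (r : ℝ) : ℝ := (r ^ 2)⁻¹ * (1 + r) ^ (-(3 / 2) : ℝ)

lemma radialWeight_nonneg {r : ℝ} (hr : 0 ≤ r) : 0 ≤ radialWeight r := by
  unfold radialWeight
  positivity

lemma integrable_radialWeight :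
    Integrable (fun x : EuclideanSpace ℝ (Fin 3) => radialWeight ‖x‖) := by
  rw [integrable_fun_norm_addHaar (volume : Measure (EuclideanSpace ℝ (Fin 3)))]
  have h := integrableOn_add_rpow_Ioi_of_lt (a := -(3 / 2)) (c := 0) (m := 1)
    (by norm_num) (by norm_num)
  refine h.congr_fun (fun y hy => ?_) measurableSet_Ioi
  have hy : (0 : ℝ) < y := hy
  simp only [finrank_euclideanSpace, Fintype.card_fin, radialWeight, smul_eq_mul]
  rw [← mul_assoc, mul_inv_cancel₀ (by positivity), one_mul, add_comm]

lemma inv_sq_mul_inv_sq_le_radialWeight {r : ℝ} (hr : 0 ≤ r) :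
    (r ^ 2)⁻¹ * ((1 + r) ^ 2)⁻¹ ≤ radialWeight r := by
  unfold radialWeight
  gcongr
  rw [← Real.rpow_two, ← Real.rpow_neg (by positivity)]
  exact Real.rpow_le_rpow_of_exponent_le (by linarith) (by norm_num)

lemma rpow_le_radialWeight {r : ℝ} (hr : 1 / 2 ≤ r) :
    r * (1 / r ^ 2) ^ (9 / 4 : ℝ) ≤ 9 * radialWeight r := by
  have hr0 : 0 < r := by linarith
  have h1 : (1 / r ^ 2) ^ (9 / 4 : ℝ) = (r ^ 3)⁻¹ * r ^ (-(3 / 2) : ℝ) := by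
    rw [one_div, ← Real.rpow_two, ← Real.rpow_neg hr0.le, ← Real.rpow_mul hr0.le,
      ← Real.rpow_natCast, ← Real.rpow_neg hr0.le, ← Real.rpow_add hr0]
    norm_num
  have h2 : r ^ (-(3 / 2) : ℝ) ≤ 9 * (1 + r) ^ (-(3 / 2) : ℝ) := by
    have h3 : r ^ (-(3 / 2) : ℝ) ≤ ((1 + r) / 3) ^ (-(3 / 2) : ℝ) :=
      Real.rpow_le_rpow_of_nonpos (by positivity) (by linarith) (by norm_num)
    have h4 : (3 : ℝ) ^ (3 / 2 : ℝ) ≤ 9 := by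
      have := Real.rpow_le_rpow_of_exponent_le (x := 3) (by norm_num)
        (show (3 / 2 : ℝ) ≤ 2 by norm_num)
      norm_num at this ⊢
      exact this
    rw [Real.div_rpow (by positivity) (by norm_num), Real.rpow_neg (x := 3) (by norm_num),
      div_inv_eq_mul, mul_comm] at h3
    refine h3.trans ?_
    gcongr
  calc r * (1 / r ^ 2) ^ (9 / 4 : ℝ) = (r ^ 2)⁻¹ * r ^ (-(3 / 2) : ℝ) := by
        rw [h1]
        field_simp
    _ ≤ (r ^ 2)⁻¹ * (9 * (1 + r) ^ (-(3 / 2) : ℝ)) := by gcongr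
    _ = 9 * radialWeight r := by
        unfold radialWeight
        ring

lemma abs_lhyIntegrand_le {b r : ℝ} (hb : 1 ≤ b) (hr : 0 < r) :
    |lhyIntegrand b r| ≤ 4 * b ^ 3 * radialWeight r := by
  have hr2 : 0 < r ^ 2 := by positivity
  obtain ⟨h0, h1, h2⟩ := lhyProfile_bounds (b := b) (by linarith) hr2
  rw [lhyIntegrand_eq_lhyProfile, abs_of_nonneg h0]
  have hw : 4 * b ^ 3 * ((r ^ 2)⁻¹ * ((1 + r) ^ 2)⁻¹) ≤ 4 * b ^ 3 * radialWeight r :=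
    mul_le_mul_of_nonneg_left (inv_sq_mul_inv_sq_le_radialWeight hr.le) (by positivity)
  have he : 4 * b ^ 3 * ((r ^ 2)⁻¹ * ((1 + r) ^ 2)⁻¹) = b ^ 3 * 4 / (r ^ 2 * (1 + r) ^ 2) := by
    field_simp
  rw [he] at hw
  refine le_trans ?_ hw
  rcases le_total r 1 with h | h
  · refine h1.trans ?_
    have hb3 : b ^ 2 ≤ b ^ 3 := pow_le_pow_right₀ hb (by norm_num)
    rw [div_le_div_iff₀ (by positivity) (by positivity)]
    have : (1 + r) ^ 2 ≤ 4 := by nlinarith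
    calc b ^ 2 * (r ^ 2 * (1 + r) ^ 2) ≤ b ^ 3 * (r ^ 2 * 4) := by gcongr
      _ ≤ b ^ 3 * 4 * (2 * r ^ 2) := by
        have : 0 < b ^ 3 * r ^ 2 := by positivity
        linarith
  · refine h2.trans ?_
    rw [div_le_div_iff₀ (by positivity) (by positivity)]
    have : (1 + r) ^ 2 ≤ 4 * r ^ 2 := by nlinarith
    calc b ^ 3 * (r ^ 2 * (1 + r) ^ 2) ≤ b ^ 3 * (r ^ 2 * (4 * r ^ 2)) := by gcongr
      _ ≤ b ^ 3 * 4 * (2 * (r ^ 2) ^ 2) := by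
        have : 0 < b ^ 3 * r ^ 4 := by positivity
        linarith

lemma integrable_lhyIntegrand_norm {b : ℝ} (hb : 1 ≤ b) :
    Integrable (fun p : EuclideanSpace ℝ (Fin 3) => lhyIntegrand b ‖p‖) := by
  refine (integrable_radialWeight.const_mul (4 * b ^ 3)).mono' ?_ ?_
  · unfold lhyIntegrand
    exact Measurable.aestronglyMeasurable (by fun_prop)
  · filter_upwards [compl_mem_ae_iff.2 (measure_singleton (0 : EuclideanSpace ℝ (Fin 3)))] with x hx
    exact abs_lhyIntegrand_le hb (norm_pos_iff.2 hx)

/-- Comparison of a sum with an integral, when every fibre of `R` has unit measure. -/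
lemma summable_and_abs_tsum_sub_integral_le {α ι : Type*} [MeasurableSpace α] [Countable ι]
    [MeasurableSpace ι] [MeasurableSingletonClass ι] {μ : Measure α} {R : α → ι}
    (hR : Measurable R) (hcell : ∀ k, μ (R ⁻¹' {k}) = 1) {f M : α → ℝ} {g : ι → ℝ}
    (hf : Integrable f μ) (hM : Integrable M μ) (hfg : ∀ᵐ x ∂μ, |g (R x) - f x| ≤ M x) :
    Summable g ∧ |∑' k, g k - ∫ x, f x ∂μ| ≤ ∫ x, M x ∂μ := by
  have hmap : μ.map R = Measure.count := by
    refine Measure.ext_of_singleton fun k => ?_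
    rw [Measure.map_apply hR (measurableSet_singleton k), hcell, Measure.count_singleton]
  have hgm : Measurable g := measurable_of_countable g
  have hd : Integrable (fun x => g (R x) - f x) μ :=
    hM.mono' ((hgm.comp hR).aestronglyMeasurable.sub hf.1) hfg
  have hgR : Integrable (fun x => g (R x)) μ :=
    (hd.add hf).congr (Filter.Eventually.of_forall fun x => by simp)
  have hgc : Integrable g Measure.count := by
    rw [← hmap]
    exact (integrable_map_measure hgm.aestronglyMeasurable hR.aemeasurable).2 hgR
  have hsum : ∑' k, g k = ∫ x, g (R x) ∂μ := by
    rw [← integral_map hR.aemeasurable hgm.aestronglyMeasurable, hmap, integral_countable hgc]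
    simp [Measure.real]
  refine ⟨(integrable_count_iff.1 hgc).of_norm, ?_⟩
  rw [hsum, ← integral_sub hgR hf]
  exact norm_integral_le_of_norm_le (f := fun x => g (R x) - f x) hM hfg

/-- The point of `ℤ³` nearest to `x`, coordinatewise. -/
noncomputable def nearestLatticePoint (x : EuclideanSpace ℝ (Fin 3)) : Fin 3 → ℤ :=
  fun i => round (x i)

lemma measurable_nearestLatticePoint : Measurable nearestLatticePoint := by
  unfold nearestLatticePoint
  simp only [round_eq]
  refine measurable_pi_iff.2 fun i => Int.measurable_floor.comp ?_
  fun_prop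

lemma volume_nearestLatticePoint_fibre (k : Fin 3 → ℤ) :
    volume (nearestLatticePoint ⁻¹' {k}) = 1 := by
  have h : nearestLatticePoint ⁻¹' {k} = (WithLp.ofLp : EuclideanSpace ℝ (Fin 3) → _) ⁻¹'
      Set.univ.pi fun i => Set.Ico ((k i : ℝ) - 1 / 2) (k i + 1 / 2) := by
    ext x
    simp only [Set.mem_preimage, Set.mem_singleton_iff, nearestLatticePoint, funext_iff, round_eq,
      Int.floor_eq_iff, Set.mem_pi, Set.mem_univ, true_imp_iff, Set.mem_Ico]
    refine forall_congr' fun i => and_congr ?_ ?_ <;> constructor <;> intro h <;> linarith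
  rw [h, (PiLp.volume_preserving_ofLp (Fin 3)).measure_preimage
    (MeasurableSet.univ_pi fun i => measurableSet_Ico).nullMeasurableSet, volume_pi_pi]
  simp only [Real.volume_Ico]
  norm_num

lemma latticeNorm_eq_norm (k : Fin 3 → ℤ) :
    latticeNorm k = ‖WithLp.toLp 2 (fun i => (k i : ℝ))‖ := by
  simp [latticeNorm, EuclideanSpace.norm_eq]

lemma abs_latticeNorm_sub_norm_le (x : EuclideanSpace ℝ (Fin 3)) :
    |latticeNorm (nearestLatticePoint x) - ‖x‖| ≤ 1 := by
  rw [latticeNorm_eq_norm, abs_sub_comm]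
  refine (abs_norm_sub_norm_le _ _).trans ?_
  rw [EuclideanSpace.norm_eq, Real.sqrt_le_one, Fin.sum_univ_three]
  have h (i : Fin 3) : |x i - round (x i)| ^ 2 ≤ 1 / 4 := by
    have := abs_sub_round (x i)
    nlinarith [abs_nonneg (x i - round (x i))]
  simp only [PiLp.sub_apply, nearestLatticePoint, Real.norm_eq_abs]
  linarith [h 0, h 1, h 2]

lemma one_le_latticeNorm {k : Fin 3 → ℤ} (hk : k ≠ 0) : 1 ≤ latticeNorm k := by
  obtain ⟨i, hi⟩ := Function.ne_iff.1 hk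
  rw [latticeNorm, Real.one_le_sqrt]
  have h1 : (1 : ℝ) ≤ (k i : ℝ) ^ 2 := by
    have : 0 < k i ^ 2 := by
      have : k i ≠ 0 := hi
      positivity
    exact_mod_cast this
  exact h1.trans (Finset.single_le_sum (f := fun i => (k i : ℝ) ^ 2)
    (fun j _ => sq_nonneg _) (Finset.mem_univ i))

lemma half_le_norm {x : EuclideanSpace ℝ (Fin 3)} (hx : nearestLatticePoint x ≠ 0) :
    1 / 2 ≤ ‖x‖ := by
  obtain ⟨i, hi⟩ := Function.ne_iff.1 hx
  refine le_trans ?_ (PiLp.norm_apply_le x i)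
  by_contra! h
  rw [Real.norm_eq_abs, abs_lt] at h
  refine hi ?_
  simp only [nearestLatticePoint, round_eq, Pi.zero_apply, Int.floor_eq_iff]
  constructor <;> push_cast <;> linarith

lemma abs_lhyIntegrand_sub_le {b r s : ℝ} (hb : 0 < b) (hr : 1 / 2 ≤ r) (hs : 1 ≤ s)
    (hrs : |s - r| ≤ 1) :
    |lhyIntegrand b (2 * Real.pi * s) - lhyIntegrand b (2 * Real.pi * r)|
      ≤ 1440 * b ^ (9 / 4 : ℝ) * radialWeight r := by
  have hr0 : 0 < r := by linarith
  have hπ3 := Real.pi_gt_three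
  have hπ2 : Real.pi ^ 2 ≤ 10 := by nlinarith [Real.pi_lt_d2]
  have hπ9 : 9 ≤ Real.pi ^ 2 := by nlinarith
  have hle := abs_le.1 hrs
  have hmr : r ^ 2 ≤ (2 * Real.pi * r) ^ 2 := by
    nlinarith [sq_nonneg r, mul_le_mul_of_nonneg_right hπ9 (sq_nonneg r)]
  have hms : r ^ 2 ≤ (2 * Real.pi * s) ^ 2 := by
    have : r ≤ 2 * s := by linarith
    nlinarith [sq_nonneg s, mul_le_mul_of_nonneg_right hπ9 (sq_nonneg s)]
  have hd : |(2 * Real.pi * s) ^ 2 - (2 * Real.pi * r) ^ 2| ≤ 160 * r := by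
    have : (2 * Real.pi * s) ^ 2 - (2 * Real.pi * r) ^ 2 =
        4 * Real.pi ^ 2 * ((s - r) * (s + r)) := by ring
    rw [this, abs_mul, abs_mul (s - r), abs_of_nonneg (by positivity : 0 ≤ 4 * Real.pi ^ 2),
      abs_of_nonneg (by linarith : 0 ≤ s + r)]
    calc 4 * Real.pi ^ 2 * (|s - r| * (s + r)) ≤ 4 * 10 * (1 * (4 * r)) := by
          gcongr
          linarith
      _ = 160 * r := by ring
  rw [lhyIntegrand_eq_lhyProfile, lhyIntegrand_eq_lhyProfile]
  calc _ ≤ (b / r ^ 2) ^ (9 / 4 : ℝ) * |(2 * Real.pi * s) ^ 2 - (2 * Real.pi * r) ^ 2| :=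
        abs_lhyProfile_sub_le hb (by positivity) hms hmr
    _ ≤ (b / r ^ 2) ^ (9 / 4 : ℝ) * (160 * r) := by gcongr
    _ = 160 * b ^ (9 / 4 : ℝ) * (r * (1 / r ^ 2) ^ (9 / 4 : ℝ)) := by
        rw [div_eq_mul_one_div b, Real.mul_rpow hb.le (by positivity)]
        ring
    _ ≤ 160 * b ^ (9 / 4 : ℝ) * (9 * radialWeight r) := by
        exact mul_le_mul_of_nonneg_left (rpow_le_radialWeight hr) (by positivity)
    _ = _ := by ring

lemma abs_lhyIntegrand_le_of_le_one {b r : ℝ} (hb : 1 ≤ b) (hr : 0 < r) (hr1 : r ≤ 1) :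
    |lhyIntegrand b (2 * Real.pi * r)| ≤ 1440 * b ^ (9 / 4 : ℝ) * radialWeight r := by
  have hπ3 := Real.pi_gt_three
  obtain ⟨h0, h1, -⟩ := lhyProfile_bounds (b := b) (u := (2 * Real.pi * r) ^ 2)
    (by linarith) (by positivity)
  rw [lhyIntegrand_eq_lhyProfile, abs_of_nonneg h0]
  have hbb : b ^ 2 ≤ b ^ (9 / 4 : ℝ) := by
    rw [← Real.rpow_two]
    exact Real.rpow_le_rpow_of_exponent_le hb (by norm_num)
  calc _ ≤ _ := h1
    _ ≤ b ^ 2 / r ^ 2 := by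
        gcongr
        nlinarith [sq_nonneg r,
          mul_le_mul_of_nonneg_right (show 1 ≤ Real.pi ^ 2 by nlinarith) (sq_nonneg r)]
    _ = 4 * b ^ 2 * ((r ^ 2)⁻¹ * (2 ^ 2)⁻¹) := by ring
    _ ≤ 1440 * b ^ (9 / 4 : ℝ) * ((r ^ 2)⁻¹ * ((1 + r) ^ 2)⁻¹) := by
        gcongr
        · norm_num
        · linarith
    _ ≤ _ := by
        gcongr
        exact inv_sq_mul_inv_sq_le_radialWeight hr.le

/-- Riemann-sum-to-integral step at the end of the proof of Theorem 2: the lattice sum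
`S(b) = (1/2)∑_{p ∈ 2πℤ³ \ {0}} h(p)` of the LHY integrand differs from
`(1/2)(2π)⁻³ ∫_{ℝ³} h(p) dp` by at most `C b^{5/2 - c}` for some `c > 0`. -/
theorem lhy_riemann_sum_to_integral :
    ∃ c > 0, ∃ C > 0, ∀ b : ℝ, 1 ≤ b →
      Summable (fun k : {k : Fin 3 → ℤ // k ≠ 0} =>
        lhyIntegrand b (2 * Real.pi * latticeNorm k.1)) ∧
      Integrable (fun p : EuclideanSpace ℝ (Fin 3) => lhyIntegrand b ‖p‖) ∧
      |(1/2) * (∑' k : {k : Fin 3 → ℤ // k ≠ 0},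
            lhyIntegrand b (2 * Real.pi * latticeNorm k.1))
          - (1/2) * (2*Real.pi)^(-3 : ℤ) *
            ∫ p : EuclideanSpace ℝ (Fin 3), lhyIntegrand b ‖p‖|
        ≤ C * b ^ ((5:ℝ)/2 - c) := by
  have hW0 : 0 ≤ ∫ x : EuclideanSpace ℝ (Fin 3), radialWeight ‖x‖ :=
    integral_nonneg fun x => radialWeight_nonneg (norm_nonneg x)
  refine ⟨1 / 4, by norm_num,
    720 * (∫ x : EuclideanSpace ℝ (Fin 3), radialWeight ‖x‖) + 1, by positivity, fun b hb => ?_⟩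
  have hπ : 0 < 2 * Real.pi := by positivity
  have hint := integrable_lhyIntegrand_norm hb
  have hnorm (x : EuclideanSpace ℝ (Fin 3)) : ‖(2 * Real.pi) • x‖ = 2 * Real.pi * ‖x‖ := by
    rw [norm_smul, Real.norm_of_nonneg hπ.le]
  have hf : Integrable fun x : EuclideanSpace ℝ (Fin 3) => lhyIntegrand b (2 * Real.pi * ‖x‖) := by
    simpa only [hnorm] using hint.comp_smul hπ.ne'
  have hscale : ∫ x : EuclideanSpace ℝ (Fin 3), lhyIntegrand b (2 * Real.pi * ‖x‖) =
      (2 * Real.pi) ^ (-3 : ℤ) * ∫ p : EuclideanSpace ℝ (Fin 3), lhyIntegrand b ‖p‖ := by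
    have := Measure.integral_comp_smul_of_nonneg (volume : Measure (EuclideanSpace ℝ (Fin 3)))
      (fun p => lhyIntegrand b ‖p‖) (2 * Real.pi) (hR := hπ.le)
    simp only [hnorm, finrank_euclideanSpace, Fintype.card_fin, smul_eq_mul] at this
    rw [this, zpow_neg]
    norm_cast
  let g : (Fin 3 → ℤ) → ℝ :=
    Set.indicator {k | k ≠ 0} fun k => lhyIntegrand b (2 * Real.pi * latticeNorm k)
  obtain ⟨hsum, hdiff⟩ := summable_and_abs_tsum_sub_integral_le (g := g)
    measurable_nearestLatticePoint volume_nearestLatticePoint_fibre hf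
    (integrable_radialWeight.const_mul (1440 * b ^ (9 / 4 : ℝ))) (by
      filter_upwards [compl_mem_ae_iff.2 (measure_singleton (0 : EuclideanSpace ℝ (Fin 3)))]
        with x hx
      have hd := abs_latticeNorm_sub_norm_le x
      by_cases hk : nearestLatticePoint x = 0
      · have hx1 : ‖x‖ ≤ 1 := by
          simpa [hk, latticeNorm] using hd
        simpa [g, hk] using abs_lhyIntegrand_le_of_le_one hb (norm_pos_iff.2 hx) hx1
      · simpa [g, hk] using abs_lhyIntegrand_sub_le (by linarith) (half_le_norm hk)
          (one_le_latticeNorm hk) hd)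
  refine ⟨summable_subtype_iff_indicator.2 hsum, hint, ?_⟩
  have htsum : ∑' k : {k : Fin 3 → ℤ // k ≠ 0}, lhyIntegrand b (2 * Real.pi * latticeNorm k.1) =
      ∑' k, g k :=
    tsum_subtype {k : Fin 3 → ℤ | k ≠ 0} fun k => lhyIntegrand b (2 * Real.pi * latticeNorm k)
  rw [integral_const_mul] at hdiff
  rw [htsum, mul_assoc, ← hscale, ← mul_sub, abs_mul, abs_of_pos (by norm_num : (0 : ℝ) < 1 / 2),
    show (5 : ℝ) / 2 - 1 / 4 = 9 / 4 by norm_num]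
  have : 0 ≤ b ^ (9 / 4 : ℝ) := by positivity
  linarith
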